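/- The rate function is good: define I(h) = inf{ (1/2) e(l) : l an absolutely continuous path in ℝ^m with l(0) = 0 such that h is a solution of the controlled equation driven by l }, with inf over the empty set equal to +∞. Assume the modulus-of-continuity condition, the local integrability condition ∫₀¹ sup_{|x| ≤ R}(|b(s,x)| + ‖σ(s,x)‖²) ds < ∞ for every R > 0, the local Osgood-type condition for every R > 0, and the growth condition for |x| ≥ K. Then for every α > 0 the sublevel set {h ∈ C([0,1], ℝ^d) : I(h) ≤ α} is compact in C([0,1], ℝ^d) equipped with the uniform (supremum) metric. -/

import Mathlib

open MeasureTheory Set Metric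
open scoped RealInnerProductSpace ENNReal

noncomputable section

/-- Matrix times vector, landing in Euclidean space. -/
def mVec {d m : ℕ} (A : Matrix (Fin d) (Fin m) ℝ)
    (v : EuclideanSpace ℝ (Fin m)) : EuclideanSpace ℝ (Fin d) :=
  (WithLp.equiv 2 (Fin d → ℝ)).symm fun i => ∑ j, A i j * v j

/-- Transposed matrix times vector (`σᵀ x`), landing in Euclidean space. -/
def mVecT {d m : ℕ} (A : Matrix (Fin d) (Fin m) ℝ)
    (x : EuclideanSpace ℝ (Fin d)) : EuclideanSpace ℝ (Fin m) :=
  (WithLp.equiv 2 (Fin m → ℝ)).symm fun j => ∑ i, A i j * x i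

/-- Square of the Frobenius (Hilbert–Schmidt) norm `‖A‖² = ∑ᵢⱼ Aᵢⱼ²`. -/
def frobSq {d m : ℕ} (A : Matrix (Fin d) (Fin m) ℝ) : ℝ :=
  ∑ i, ∑ j, (A i j) ^ 2

/-- An admissible control: `l'` is (a.e. strongly) measurable on `[0,1]` and
`∫₀¹ ‖l'(t)‖² dt < ∞`; `l'` plays the role of the derivative of an absolutely
continuous path `l` with `l(0) = 0`, so that `e(l) = ∫₀¹ ‖l'(t)‖² dt`. -/
def Adm {m : ℕ} (l' : ℝ → EuclideanSpace ℝ (Fin m)) : Prop :=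
  AEStronglyMeasurable l' (volume.restrict (Icc 0 1)) ∧
    IntegrableOn (fun t => ‖l' t‖ ^ 2) (Icc 0 1)

/-- `h` is a solution on `[0,1]` of the controlled equation
`h(t) = x₀ + ∫₀ᵗ b(s, h(s)) ds + ∫₀ᵗ σ(s, h(s)) l'(s) ds` driven by the
absolutely continuous path `l` with derivative `l'`. -/
def IsSol {d m : ℕ} (b : ℝ → EuclideanSpace ℝ (Fin d) → EuclideanSpace ℝ (Fin d))
    (σ : ℝ → EuclideanSpace ℝ (Fin d) → Matrix (Fin d) (Fin m) ℝ)
    (x₀ : EuclideanSpace ℝ (Fin d)) (l' : ℝ → EuclideanSpace ℝ (Fin m))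
    (h : ℝ → EuclideanSpace ℝ (Fin d)) : Prop :=
  ContinuousOn h (Icc 0 1) ∧ ∀ t ∈ Icc (0:ℝ) 1,
    h t = x₀ + ∫ s in (0:ℝ)..t, (b s (h s) + mVec (σ s (h s)) (l' s))


/-- The rate function `I(h) = inf { ½ e(l) : h solves the controlled equation
driven by `l` }`, with `inf ∅ = +∞`, defined on continuous paths on `[0,1]`. -/
def rateI {d m : ℕ} (b : ℝ → EuclideanSpace ℝ (Fin d) → EuclideanSpace ℝ (Fin d))
    (σ : ℝ → EuclideanSpace ℝ (Fin d) → Matrix (Fin d) (Fin m) ℝ)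
    (x₀ : EuclideanSpace ℝ (Fin d))
    (h : C(Icc (0:ℝ) 1, EuclideanSpace ℝ (Fin d))) : ℝ≥0∞ :=
  ⨅ (l' : ℝ → EuclideanSpace ℝ (Fin m)) (_ : Adm l' ∧
      IsSol b σ x₀ l' fun t => h (projIcc (0:ℝ) 1 zero_le_one t)),
    ENNReal.ofReal ((1 / 2) * ∫ t in Icc (0:ℝ) 1, ‖l' t‖ ^ 2)

section LinearAlgebra

variable {d m : ℕ}

lemma mVec_apply (A : Matrix (Fin d) (Fin m) ℝ) (v : EuclideanSpace ℝ (Fin m)) (i : Fin d) :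
    mVec A v i = ∑ j, A i j * v j := rfl

lemma mVecT_apply (A : Matrix (Fin d) (Fin m) ℝ) (x : EuclideanSpace ℝ (Fin d)) (j : Fin m) :
    mVecT A x j = ∑ i, A i j * x i := rfl

lemma mVec_sub (A B : Matrix (Fin d) (Fin m) ℝ) (v : EuclideanSpace ℝ (Fin m)) :
    mVec (A - B) v = mVec A v - mVec B v := by
  ext i
  simp [mVec_apply, sub_mul]

lemma inner_mVec (A : Matrix (Fin d) (Fin m) ℝ) (x : EuclideanSpace ℝ (Fin d))
    (v : EuclideanSpace ℝ (Fin m)) : ⟪x, mVec A v⟫ = ⟪mVecT A x, v⟫ := by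
  simp only [PiLp.inner_apply, mVec_apply, mVecT_apply, RCLike.inner_apply, conj_trivial,
    Finset.sum_mul, Finset.mul_sum]
  rw [Finset.sum_comm]
  exact Finset.sum_congr rfl fun j _ => Finset.sum_congr rfl fun i _ => by ring

lemma frobSq_nonneg (A : Matrix (Fin d) (Fin m) ℝ) : 0 ≤ frobSq A :=
  Finset.sum_nonneg fun _ _ => Finset.sum_nonneg fun _ _ => sq_nonneg _

lemma norm_mVec_sq_le (A : Matrix (Fin d) (Fin m) ℝ) (v : EuclideanSpace ℝ (Fin m)) :
    ‖mVec A v‖ ^ 2 ≤ frobSq A * ‖v‖ ^ 2 := by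
  rw [EuclideanSpace.real_norm_sq_eq, EuclideanSpace.real_norm_sq_eq, frobSq, Finset.sum_mul]
  refine Finset.sum_le_sum fun i _ => ?_
  rw [mVec_apply]
  exact Finset.sum_mul_sq_le_sq_mul_sq _ _ _

lemma norm_mVecT_sq_le (A : Matrix (Fin d) (Fin m) ℝ) (x : EuclideanSpace ℝ (Fin d)) :
    ‖mVecT A x‖ ^ 2 ≤ frobSq A * ‖x‖ ^ 2 := by
  rw [EuclideanSpace.real_norm_sq_eq, EuclideanSpace.real_norm_sq_eq, frobSq, Finset.sum_comm,
    Finset.sum_mul]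
  refine Finset.sum_le_sum fun j _ => ?_
  rw [mVecT_apply]
  exact Finset.sum_mul_sq_le_sq_mul_sq _ _ _

lemma norm_mVec_le (A : Matrix (Fin d) (Fin m) ℝ) (v : EuclideanSpace ℝ (Fin m)) :
    ‖mVec A v‖ ≤ √(frobSq A) * ‖v‖ := by
  refine abs_le_of_sq_le_sq' ?_ (by positivity) |>.2
  rw [mul_pow, Real.sq_sqrt (frobSq_nonneg A)]
  exact norm_mVec_sq_le A v

lemma frobSq_le_two_mul (A B : Matrix (Fin d) (Fin m) ℝ) :
    frobSq A ≤ 2 * frobSq B + 2 * frobSq (A - B) := by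
  simp only [frobSq, Finset.mul_sum, ← Finset.sum_add_distrib, Matrix.sub_apply]
  refine Finset.sum_le_sum fun i _ => Finset.sum_le_sum fun j _ => ?_
  nlinarith [sq_nonneg (B i j - (A i j - B i j))]

/-- Young's inequality for the product of a matrix and a vector. -/
lemma norm_mVec_le_young (A : Matrix (Fin d) (Fin m) ℝ) (v : EuclideanSpace ℝ (Fin m))
    {δ : ℝ} (hδ : 0 < δ) : ‖mVec A v‖ ≤ frobSq A / δ + δ * ‖v‖ ^ 2 := by
  have h1 := norm_mVec_le A v
  have h2 := Real.sq_sqrt (frobSq_nonneg A)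
  have h3 : frobSq A / δ + δ * ‖v‖ ^ 2 - √(frobSq A) * ‖v‖
      = ((√(frobSq A) - δ * ‖v‖) ^ 2 + √(frobSq A) * (δ * ‖v‖)) / δ := by
    field_simp
    linear_combination -h2
  have h4 : 0 ≤ ((√(frobSq A) - δ * ‖v‖) ^ 2 + √(frobSq A) * (δ * ‖v‖)) / δ := by positivity
  linarith

end LinearAlgebra

/-- A sequence in a Hilbert space whose norms are dominated by a convergent real sequence converges
weakly along the hyperfilter, with the corresponding bound on the norm of the limit. -/
lemma exists_weak_limit_hyperfilter {V : Type*} [NormedAddCommGroup V] [InnerProductSpace ℝ V]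
    [CompleteSpace V] (L : ℕ → V) (a : ℕ → ℝ) (a₀ : ℝ) (ha : Filter.Tendsto a Filter.atTop (nhds a₀))
    (hL : ∀ n, ‖L n‖ ≤ a n) :
    ∃ x : V, ‖x‖ ≤ a₀ ∧
      ∀ v, Filter.Tendsto (fun n => ⟪L n, v⟫) (Filter.hyperfilter ℕ : Filter ℕ) (nhds ⟪x, v⟫) := by
  obtain ⟨r, hr⟩ := ha.bddAbove_range
  have hyp_le : (Filter.hyperfilter ℕ : Filter ℕ) ≤ Filter.atTop :=
    Nat.hyperfilter_le_atTop
  let Φ : ℕ → WeakDual ℝ V := fun n => StrongDual.toWeakDual (InnerProductSpace.toDual ℝ V (L n))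
  have hcomp := WeakDual.isCompact_closedBall (𝕜 := ℝ) (E := V) 0 r
  have hmem : ∀ n, Φ n ∈ WeakDual.toStrongDual ⁻¹' closedBall (0 : StrongDual ℝ V) r := by
    intro n
    have : ‖InnerProductSpace.toDual ℝ V (L n)‖ ≤ r := by
      rw [LinearIsometryEquiv.norm_map]
      exact (hL n).trans (hr ⟨n, rfl⟩)
    simpa [Φ] using this
  obtain ⟨φ, -, hφ⟩ := hcomp.ultrafilter_le_nhds ((Filter.hyperfilter ℕ).map Φ)
    (by
      rw [Filter.le_principal_iff, Ultrafilter.coe_map, Filter.mem_map]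
      exact Filter.Eventually.of_forall hmem)
  have hφ' : Filter.Tendsto Φ (Filter.hyperfilter ℕ : Filter ℕ) (nhds φ) := hφ
  let x : V := (InnerProductSpace.toDual ℝ V).symm (WeakDual.toStrongDual φ)
  have hlim : ∀ v, Filter.Tendsto (fun n => ⟪L n, v⟫) (Filter.hyperfilter ℕ : Filter ℕ)
      (nhds ⟪x, v⟫) := by
    intro v
    have h1 := ((WeakDual.eval_continuous (𝕜 := ℝ) v).tendsto φ).comp hφ'
    have h2 : ⟪x, v⟫ = φ v := by
      simp only [x]
      rw [InnerProductSpace.toDual_symm_apply]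
      rfl
    rw [h2]
    exact h1
  refine ⟨x, ?_, hlim⟩
  have h3 : ⟪x, x⟫ ≤ a₀ * ‖x‖ := by
    refine le_of_tendsto_of_tendsto (hlim x) ((ha.mono_left hyp_le).mul_const ‖x‖)
      (Filter.Eventually.of_forall fun n => ?_)
    exact (real_inner_le_norm _ _).trans (mul_le_mul_of_nonneg_right (hL n) (norm_nonneg _))
  rw [real_inner_self_eq_norm_sq, sq] at h3
  rcases (norm_nonneg x).eq_or_lt with h | h
  · rw [← h]
    exact ge_of_tendsto' ha fun n => (norm_nonneg _).trans (hL n)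
  · exact le_of_mul_le_mul_right h3 h

/-- An unbounded primitive: if `1 / ψ` is not integrable at infinity, its primitive exceeds every
bound. -/
lemma exists_lt_integral_one_div {ψ : ℝ → ℝ} (hψ : Continuous ψ) (hψ1 : ∀ x, 1 ≤ ψ x) {K : ℝ}
    (hint : ∫⁻ s in Ioi K, ENNReal.ofReal (1 / ψ s) = ⊤) (B : ℝ) :
    ∃ R, B < ∫ x in (0:ℝ)..R, 1 / ψ x := by
  by_contra! hcon
  have hpos : ∀ x, 0 < ψ x := fun x => one_pos.trans_le (hψ1 x)
  have hc : Continuous fun x => 1 / ψ x := continuous_const.div hψ fun x => (hpos x).ne'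
  have hI : IntegrableOn (fun x => 1 / ψ x) (Ioi K) := by
    refine integrableOn_Ioi_of_intervalIntegral_norm_bounded
      (B - ∫ x in (0:ℝ)..K, 1 / ψ x) K (l := Filter.atTop) (b := id)
      (fun i => hc.integrableOn_Ioc) Filter.tendsto_id (Filter.Eventually.of_forall fun i => ?_)
    have h1 : ∀ x, ‖1 / ψ x‖ = 1 / ψ x := fun x =>
      Real.norm_of_nonneg (one_div_nonneg.2 (hpos x).le)
    simp only [h1, id]
    have := intervalIntegral.integral_add_adjacent_intervals (hc.intervalIntegrable 0 K)
      (hc.intervalIntegrable (μ := volume) K i)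
    linarith [hcon i]
  have h2 := hI.lintegral_lt_top
  exact h2.ne hint

/-- Bihari-type a priori bound: paths whose squared norm satisfies the differential inequality
`(‖h‖²)' ≤ k ψ(‖h‖²)` outside a ball are bounded in terms of `∫ k` only, provided that `1 / ψ` is
not integrable at infinity. -/
lemma exists_norm_sq_bound {E : Type*} [NormedAddCommGroup E] [InnerProductSpace ℝ E]
    [CompleteSpace E] {ψ : ℝ → ℝ} (hψ : Continuous ψ) (hψ1 : ∀ x, 1 ≤ ψ x) {K : ℝ}
    (hint : ∫⁻ s in Ioi K, ENNReal.ofReal (1 / ψ s) = ⊤) {N M : ℝ} (hNM : N < M) (C : ℝ) :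
    ∃ R, ∀ (h F : ℝ → E) (k : ℝ → ℝ), Continuous h → IntegrableOn F (Icc 0 1) →
      IntegrableOn k (Icc 0 1) → (∀ t, 0 ≤ k t) → ∫ t in Icc (0:ℝ) 1, k t ≤ C →
      (∀ s ∈ Icc (0:ℝ) 1, ∀ t ∈ Icc (0:ℝ) 1, h t - h s = ∫ r in s..t, F r) →
      (∀ r ∈ Icc (0:ℝ) 1, N ≤ ‖h r‖ ^ 2 → 2 * ⟪h r, F r⟫ ≤ k r * ψ (‖h r‖ ^ 2)) →
      ‖h 0‖ ^ 2 ≤ M → ∀ t ∈ Icc (0:ℝ) 1, ‖h t‖ ^ 2 ≤ R := by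
  have hpos : ∀ x, 0 < ψ x := fun x => one_pos.trans_le (hψ1 x)
  have hc : Continuous fun x => 1 / ψ x := continuous_const.div hψ fun x => (hpos x).ne'
  have hnn : ∀ x, 0 ≤ 1 / ψ x := fun x => (one_div_pos.2 (hpos x)).le
  set Γ : ℝ → ℝ := fun x => ∫ y in (0:ℝ)..x, 1 / ψ y with hΓ
  have hΓsub : ∀ x y, Γ y - Γ x = ∫ z in x..y, 1 / ψ z := fun x y =>
    intervalIntegral.integral_interval_sub_left (hc.intervalIntegrable _ _)
      (hc.intervalIntegrable _ _)
  have hΓcont : Continuous Γ := intervalIntegral.continuous_primitive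
    (fun a b => hc.intervalIntegrable a b) 0
  have hΓmono : Monotone Γ := fun x y hxy => by
    have := intervalIntegral.integral_nonneg (μ := volume) hxy fun z _ => hnn z
    linarith [hΓsub x y]
  obtain ⟨R, hR⟩ := exists_lt_integral_one_div hψ hψ1 hint (Γ M + (4 * C + 1))
  refine ⟨R, fun h F k hh hF hk hk0 hkC hhF hineq hh0 t ht => ?_⟩
  set ε : ℝ := 1 / (1 + ∫ s in Icc (0:ℝ) 1, ‖F s‖) with hε
  have hFI : 0 ≤ ∫ s in Icc (0:ℝ) 1, ‖F s‖ := integral_nonneg fun _ => norm_nonneg _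
  have hε0 : 0 < ε := by positivity
  have hεF : ε * (∫ s in Icc (0:ℝ) 1, ‖F s‖) ≤ 1 := by
    rw [hε, one_div, inv_mul_le_iff₀ (by positivity)]
    linarith
  set q : ℝ → ℝ := fun s => 4 * k s + ε * ‖F s‖ with hq
  have hq0 : ∀ s, 0 ≤ q s := fun s => by
    have := hk0 s
    positivity
  have hqI : IntegrableOn q (Icc 0 1) := (hk.const_mul 4).add (hF.norm.const_mul ε)
  have hII : ∀ {f : ℝ → ℝ}, IntegrableOn f (Icc 0 1) →
      ∀ s ∈ Icc (0:ℝ) 1, ∀ t ∈ Icc (0:ℝ) 1, IntervalIntegrable f volume s t := by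
    intro f hf s hs t ht
    exact (hf.mono_set (uIcc_subset_Icc hs ht)).intervalIntegrable
  have h01 : (0:ℝ) ∈ Icc (0:ℝ) 1 := ⟨le_rfl, zero_le_one⟩
  have h11 : (1:ℝ) ∈ Icc (0:ℝ) 1 := ⟨zero_le_one, le_rfl⟩
  set Q : ℝ → ℝ := fun s => ∫ r in (0:ℝ)..s, q r with hQ
  have hQcont : ContinuousOn Q (Icc 0 1) := by
    have := intervalIntegral.continuousOn_primitive_interval (μ := volume) (f := q) (a := 0) (b := 1)
      (by rwa [uIcc_of_le zero_le_one])
    rwa [uIcc_of_le zero_le_one] at this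
  have hQsub : ∀ s ∈ Icc (0:ℝ) 1, ∀ t ∈ Icc (0:ℝ) 1, Q t - Q s = ∫ r in s..t, q r :=
    fun s hs t ht => intervalIntegral.integral_interval_sub_left (hII hqI _ h01 _ ht)
      (hII hqI _ h01 _ hs)
  have hQmono : ∀ s ∈ Icc (0:ℝ) 1, ∀ t ∈ Icc (0:ℝ) 1, s ≤ t → Q s ≤ Q t := fun s hs t ht hst => by
    have := intervalIntegral.integral_nonneg (μ := volume) hst fun z _ => hq0 z
    linarith [hQsub s hs t ht]
  have hQ0 : Q 0 = 0 := intervalIntegral.integral_same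
  have hQ1 : Q 1 ≤ 4 * C + 1 := by
    rw [hQ]
    simp only
    rw [intervalIntegral.integral_of_le zero_le_one, ← integral_Icc_eq_integral_Ioc, hq,
      integral_add (hk.const_mul 4) (hF.norm.const_mul ε), integral_const_mul, integral_const_mul]
    linarith
  have hucont : Continuous fun t => ‖h t‖ ^ 2 := hh.norm.pow 2
  suffices hmain : Icc (0:ℝ) 1 ⊆ {t | Γ (‖h t‖ ^ 2) ≤ Γ M + Q t} by
    have h1 : Γ (‖h t‖ ^ 2) ≤ Γ M + Q t := hmain ht
    have h2 := hQmono t ht 1 h11 ht.2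
    by_contra! h3
    have h4 : Γ R ≤ Γ (‖h t‖ ^ 2) := hΓmono h3.le
    linarith
  refine IsClosed.Icc_subset_of_forall_mem_nhdsWithin ?_ ?_ ?_
  · have := isClosed_Icc.isClosed_le (hΓcont.comp hucont).continuousOn
      (continuousOn_const (c := Γ M).add hQcont)
    rw [inter_comm]
    exact this
  · change Γ (‖h 0‖ ^ 2) ≤ Γ M + Q 0
    linarith [hΓmono hh0]
  rintro x ⟨hx, hx01⟩
  have hxI : x ∈ Icc (0:ℝ) 1 := ⟨hx01.1, hx01.2.le⟩
  have hx' : Γ (‖h x‖ ^ 2) ≤ Γ M + Q x := hx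
  have hyI : ∀ᶠ y in nhdsWithin x (Ioi x), y ∈ Ioc x 1 := Ioc_mem_nhdsGT hx01.2
  rcases lt_or_ge (‖h x‖ ^ 2) M with hxM | hxM
  · have h1 : ∀ᶠ y in nhdsWithin x (Ioi x), ‖h y‖ ^ 2 < M :=
      (hucont.continuousAt.eventually_lt continuousAt_const hxM).filter_mono nhdsWithin_le_nhds
    filter_upwards [h1, hyI] with y hy hy1
    have h2 := hQmono 0 h01 y ⟨hx01.1.trans hy1.1.le, hy1.2⟩ (hx01.1.trans hy1.1.le)
    have h3 := hΓmono hy.le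
    change Γ (‖h y‖ ^ 2) ≤ Γ M + Q y
    linarith
  set w := ‖h x‖ ^ 2 with hw
  set p := ψ w with hp
  have hp1 : 1 ≤ p := hψ1 w
  have e1 : ∀ᶠ v in nhds w, N < v ∧ ψ v < 2 * p ∧ p / 2 < ψ v := by
    refine (lt_mem_nhds (hNM.trans_le hxM)).and
      ((hψ.continuousAt.eventually_lt continuousAt_const (by linarith)).and
        (continuousAt_const.eventually_lt hψ.continuousAt (by linarith)))
  obtain ⟨δ', hδ', e2⟩ := Metric.eventually_nhds_iff_ball.1 e1
  have e3 : ∀ᶠ r in nhds x, ‖h r‖ ^ 2 ∈ ball w δ' ∧ h r ∈ ball (h x) (ε / 8) :=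
    (hucont.continuousAt.eventually (ball_mem_nhds _ hδ')).and
      (hh.continuousAt.eventually (ball_mem_nhds _ (by positivity)))
  obtain ⟨δ, hδ, e4⟩ := Metric.eventually_nhds_iff_ball.1 e3
  have hyδ : ∀ᶠ y in nhdsWithin x (Ioi x), y ∈ ball x δ :=
    nhdsWithin_le_nhds (ball_mem_nhds _ hδ)
  filter_upwards [hyI, hyδ] with y hy hyd
  have hyI' : y ∈ Icc (0:ℝ) 1 := ⟨hx01.1.trans hy.1.le, hy.2⟩
  have hrd : ∀ r ∈ Icc x y, r ∈ ball x δ := fun r hr =>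
    (convex_ball x δ).ordConnected.out (mem_ball_self hδ) hyd hr
  have hrI : ∀ r ∈ Icc x y, r ∈ Icc (0:ℝ) 1 := fun r hr => ⟨hx01.1.trans hr.1, hr.2.trans hy.2⟩
  have hFxy : IntervalIntegrable F volume x y :=
    (hF.mono_set (uIcc_subset_Icc hxI hyI')).intervalIntegrable
  have hu : ‖h y‖ ^ 2 - w ≤ p / 2 * ∫ r in x..y, q r := by
    have h1 : ‖h y‖ ^ 2 - w = ∫ r in x..y, ⟪h y + h x, F r⟫ := by
      have h2 := (innerSL ℝ (h y + h x)).intervalIntegral_comp_comm hFxy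
      simp only [innerSL_apply_apply] at h2
      rw [h2, ← hhF x hxI y hyI', inner_add_left, inner_sub_right, inner_sub_right,
        real_inner_self_eq_norm_sq, real_inner_self_eq_norm_sq, real_inner_comm (h x) (h y)]
      ring
    rw [h1, ← intervalIntegral.integral_const_mul]
    refine intervalIntegral.integral_mono_on hy.1.le ?_ ((hII hqI x hxI y hyI').const_mul _) ?_
    · have := hFxy.norm
      rw [intervalIntegrable_iff] at hFxy ⊢
      exact (innerSL ℝ (h y + h x)).integrable_comp hFxy
    intro r hr
    obtain ⟨hr1, hr2⟩ := e4 r (hrd r hr)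
    obtain ⟨-, hy2⟩ := e4 y hyd
    obtain ⟨g1, g2, -⟩ := e2 _ hr1
    have h3 := hineq r (hrI r hr) g1.le
    have h4 : ⟪h y + h x, F r⟫ = 2 * ⟪h r, F r⟫ + ⟪(h y - h x) - (2:ℝ) • (h r - h x), F r⟫ := by
      rw [inner_sub_left, real_inner_smul_left, inner_sub_left, inner_sub_left, inner_add_left]
      ring
    have h5 : ‖(h y - h x) - (2:ℝ) • (h r - h x)‖ ≤ ε / 2 := by
      rw [mem_ball, dist_eq_norm] at hr2 hy2
      refine (norm_sub_le _ _).trans ?_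
      rw [norm_smul]
      norm_num
      linarith
    have h6 := real_inner_le_norm ((h y - h x) - (2:ℝ) • (h r - h x)) (F r)
    have h7 := mul_le_mul_of_nonneg_right h5 (norm_nonneg (F r))
    have h8 := mul_le_mul_of_nonneg_left g2.le (hk0 r)
    have h9 : ε / 2 * ‖F r‖ ≤ p * (ε / 2 * ‖F r‖) := le_mul_of_one_le_left (by positivity) hp1
    simp only [hq]
    nlinarith
  have hΓle : Γ (‖h y‖ ^ 2) - Γ w ≤ ∫ r in x..y, q r := by
    have hqn : 0 ≤ ∫ r in x..y, q r :=
      intervalIntegral.integral_nonneg hy.1.le fun z _ => hq0 z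
    rcases le_total (‖h y‖ ^ 2) w with hle | hle
    · linarith [hΓmono hle]
    rw [hΓsub]
    have h1 : ∫ z in w..‖h y‖ ^ 2, 1 / ψ z ≤ ∫ z in w..‖h y‖ ^ 2, 2 / p := by
      refine intervalIntegral.integral_mono_on hle (hc.intervalIntegrable _ _)
        intervalIntegrable_const fun z hz => ?_
      have hz' : z ∈ ball w δ' :=
        (convex_ball w δ').ordConnected.out (mem_ball_self hδ') (e4 y hyd).1 hz
      obtain ⟨-, -, g3⟩ := e2 z hz'
      rw [div_le_div_iff₀ (hpos z) (by linarith)]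
      linarith
    rw [intervalIntegral.integral_const, smul_eq_mul] at h1
    refine h1.trans ?_
    rw [← mul_div_assoc, div_le_iff₀ (by linarith)]
    linarith
  change Γ (‖h y‖ ^ 2) ≤ Γ M + Q y
  linarith [hQsub x hxI y hyI']

section Paths

variable {d m : ℕ}

lemma aestronglyMeasurable_mVec {μ : Measure ℝ} {A : ℝ → Matrix (Fin d) (Fin m) ℝ}
    (hA : ∀ i j, Measurable fun s => A s i j) {l : ℝ → EuclideanSpace ℝ (Fin m)}
    (hl : AEStronglyMeasurable l μ) : AEStronglyMeasurable (fun s => mVec (A s) (l s)) μ := by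
  refine AEMeasurable.aestronglyMeasurable ?_
  refine (PiLp.continuous_toLp 2 fun _ : Fin d => ℝ).measurable.comp_aemeasurable
    (aemeasurable_pi_iff.2 fun i => ?_)
  refine Finset.aemeasurable_fun_sum _ fun j _ => (hA i j).aemeasurable.mul ?_
  exact ((EuclideanSpace.proj (𝕜 := ℝ) j).continuous.comp_aestronglyMeasurable hl).aemeasurable

lemma measurable_mVecT {A : ℝ → Matrix (Fin d) (Fin m) ℝ}
    (hA : ∀ i j, Measurable fun s => A s i j) (x : EuclideanSpace ℝ (Fin d)) :
    Measurable fun s => mVecT (A s) x := by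
  refine (PiLp.continuous_toLp 2 fun _ : Fin m => ℝ).measurable.comp (measurable_pi_iff.2 fun j => ?_)
  exact Finset.measurable_fun_sum _ fun i _ => (hA i j).mul_const _

/-- Measurable coefficients that are dominated, uniformly on bounded sets of the space variable, by
an integrable function of time. -/
structure DominatedCoeff (b : ℝ → EuclideanSpace ℝ (Fin d) → EuclideanSpace ℝ (Fin d))
    (σ : ℝ → EuclideanSpace ℝ (Fin d) → Matrix (Fin d) (Fin m) ℝ) : Prop where
  measurable_drift : Measurable (Function.uncurry b)
  measurable_diffusion : ∀ i j, Measurable fun p : ℝ × EuclideanSpace ℝ (Fin d) => σ p.1 p.2 i j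
  exists_bound : ∀ R > (0:ℝ), ∃ Θ : ℝ → ℝ, IntegrableOn Θ (Icc 0 1) ∧
    ∀ t ∈ Icc (0:ℝ) 1, ∀ x, ‖x‖ ≤ R → ‖b t x‖ + frobSq (σ t x) ≤ Θ t

variable {b : ℝ → EuclideanSpace ℝ (Fin d) → EuclideanSpace ℝ (Fin d)}
  {σ : ℝ → EuclideanSpace ℝ (Fin d) → Matrix (Fin d) (Fin m) ℝ} {x₀ : EuclideanSpace ℝ (Fin d)}

/-- A nonnegative function with integrable square is integrable on `[0, 1]`. -/
lemma integrableOn_of_sq {G : ℝ → ℝ} (hG : ∀ t, 0 ≤ G t)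
    (hG_int : IntegrableOn (fun t => G t ^ 2) (Icc 0 1)) : IntegrableOn G (Icc 0 1) := by
  have h1 : AEStronglyMeasurable G (volume.restrict (Icc 0 1)) := by
    have := Real.continuous_sqrt.comp_aestronglyMeasurable hG_int.aestronglyMeasurable
    refine this.congr (Filter.Eventually.of_forall fun t => ?_)
    exact Real.sqrt_sq (hG t)
  refine Integrable.mono' ((integrable_const (1:ℝ)).add hG_int) h1
    (Filter.Eventually.of_forall fun t => ?_)
  rw [Real.norm_of_nonneg (hG t)]
  simp only [Pi.add_apply]
  nlinarith [sq_nonneg (G t - 1), sq_nonneg (G t)]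

lemma dominatedCoeff_of_modulus (hbmeas : Measurable (Function.uncurry b))
    (hσmeas : ∀ i j, Measurable fun p : ℝ × EuclideanSpace ℝ (Fin d) => σ p.1 p.2 i j)
    {H G : ℝ → ℝ} (hH_mono : MonotoneOn H (Ici 0))
    (hG_nonneg : ∀ t, 0 ≤ G t) (hG_int : IntegrableOn (fun t => G t ^ 2) (Icc 0 1))
    (hmod : ∀ t ∈ Icc (0:ℝ) 1, ∀ x y,
      √(frobSq (σ t x - σ t y)) + ‖b t x - b t y‖ ≤ G t * H ‖x - y‖)
    (hzero : ∫⁻ s in Icc (0:ℝ) 1, ENNReal.ofReal (‖b s 0‖ + frobSq (σ s 0)) < ⊤) :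
    DominatedCoeff b σ := by
  refine ⟨hbmeas, hσmeas, fun R hR => ?_⟩
  have hb0 : Measurable fun s => b s 0 := hbmeas.comp (measurable_id.prodMk measurable_const)
  have hσ0 : ∀ i j, Measurable fun s => σ s 0 i j := fun i j =>
    (hσmeas i j).comp (measurable_id.prodMk measurable_const)
  have hf0 : Measurable fun s => frobSq (σ s 0) :=
    Finset.measurable_fun_sum _ fun i _ => Finset.measurable_fun_sum _ fun j _ => (hσ0 i j).pow_const 2
  have h0 : IntegrableOn (fun s => ‖b s 0‖ + frobSq (σ s 0)) (Icc 0 1) := by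
    refine ⟨(hb0.norm.add hf0).aestronglyMeasurable, ?_⟩
    rw [hasFiniteIntegral_iff_ofReal (Filter.Eventually.of_forall fun s =>
      add_nonneg (norm_nonneg _) (frobSq_nonneg _))]
    exact hzero
  have hGi := integrableOn_of_sq hG_nonneg hG_int
  have hGI : IntegrableOn (fun t => H R * G t + 2 * H R ^ 2 * G t ^ 2) (Icc 0 1) :=
    (hGi.const_mul (H R)).add (hG_int.const_mul (2 * H R ^ 2))
  have hΘ : IntegrableOn
      (fun t => 2 * (‖b t 0‖ + frobSq (σ t 0)) + (H R * G t + 2 * H R ^ 2 * G t ^ 2)) (Icc 0 1) :=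
    Integrable.add (h0.const_mul 2) hGI
  refine ⟨fun t => 2 * (‖b t 0‖ + frobSq (σ t 0)) + (H R * G t + 2 * H R ^ 2 * G t ^ 2),
    hΘ, fun t ht x hx => ?_⟩
  have h1 := hmod t ht x 0
  rw [sub_zero] at h1
  have h2 : H ‖x‖ ≤ H R := hH_mono (norm_nonneg x) hR.le hx
  have h3 := mul_le_mul_of_nonneg_left h2 (hG_nonneg t)
  have h4 := Real.sqrt_nonneg (frobSq (σ t x - σ t 0))
  have h5 := norm_nonneg (b t x - b t 0)
  have h6 : ‖b t x‖ ≤ ‖b t 0‖ + ‖b t x - b t 0‖ := norm_le_norm_add_norm_sub' _ _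
  have h7 : frobSq (σ t x - σ t 0) ≤ (G t * H R) ^ 2 := by
    rw [← Real.sq_sqrt (frobSq_nonneg (σ t x - σ t 0))]
    exact pow_le_pow_left₀ h4 (by linarith) 2
  have h8 := frobSq_le_two_mul (σ t x) (σ t 0)
  have h9 := norm_nonneg (b t 0)
  nlinarith

lemma DominatedCoeff.measurable_drift_comp (hD : DominatedCoeff b σ)
    {h : ℝ → EuclideanSpace ℝ (Fin d)} (hh : Continuous h) : Measurable fun s => b s (h s) :=
  hD.measurable_drift.comp (measurable_id.prodMk hh.measurable)

lemma DominatedCoeff.measurable_diffusion_comp (hD : DominatedCoeff b σ)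
    {h : ℝ → EuclideanSpace ℝ (Fin d)} (hh : Continuous h) (i : Fin d) (j : Fin m) :
    Measurable fun s => σ s (h s) i j :=
  (hD.measurable_diffusion i j).comp (measurable_id.prodMk hh.measurable)

lemma DominatedCoeff.exists_bound_path (hD : DominatedCoeff b σ)
    {h : ℝ → EuclideanSpace ℝ (Fin d)} (hh : Continuous h) :
    ∃ Θ : ℝ → ℝ, IntegrableOn Θ (Icc 0 1) ∧
      ∀ t ∈ Icc (0:ℝ) 1, ‖b t (h t)‖ + frobSq (σ t (h t)) ≤ Θ t := by
  obtain ⟨R, hR⟩ := isCompact_Icc.exists_bound_of_continuousOn hh.continuousOn (s := Icc (0:ℝ) 1)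
  obtain ⟨Θ, hΘ, hb⟩ := hD.exists_bound (max R 1) (by positivity)
  exact ⟨Θ, hΘ, fun t ht => hb t ht _ ((hR t ht).trans (le_max_left _ _))⟩

lemma DominatedCoeff.integrableOn_drift (hD : DominatedCoeff b σ)
    {h : ℝ → EuclideanSpace ℝ (Fin d)} (hh : Continuous h) :
    IntegrableOn (fun s => b s (h s)) (Icc 0 1) := by
  obtain ⟨Θ, hΘ, hb⟩ := hD.exists_bound_path hh
  refine Integrable.mono' hΘ (hD.measurable_drift_comp hh).aestronglyMeasurable ?_
  filter_upwards [ae_restrict_mem measurableSet_Icc] with t ht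
  linarith [hb t ht, frobSq_nonneg (σ t (h t))]

lemma DominatedCoeff.integrableOn_diffusion (hD : DominatedCoeff b σ)
    {h : ℝ → EuclideanSpace ℝ (Fin d)} (hh : Continuous h) {l : ℝ → EuclideanSpace ℝ (Fin m)}
    (hl : Adm l) : IntegrableOn (fun s => mVec (σ s (h s)) (l s)) (Icc 0 1) := by
  obtain ⟨Θ, hΘ, hb⟩ := hD.exists_bound_path hh
  refine Integrable.mono' (hΘ.add hl.2)
    (aestronglyMeasurable_mVec (hD.measurable_diffusion_comp hh) hl.1) ?_
  filter_upwards [ae_restrict_mem measurableSet_Icc] with t ht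
  have h1 := norm_mVec_le_young (σ t (h t)) (l t) one_pos
  simp only [Pi.add_apply]
  linarith [hb t ht, norm_nonneg (b t (h t))]

lemma intervalIntegrable_of_Icc {E : Type*} [NormedAddCommGroup E] {f : ℝ → E}
    (hf : IntegrableOn f (Icc 0 1)) {s t : ℝ} (hs : s ∈ Icc (0:ℝ) 1) (ht : t ∈ Icc (0:ℝ) 1) :
    IntervalIntegrable f volume s t :=
  (hf.mono_set (uIcc_subset_Icc hs ht)).intervalIntegrable

lemma intervalIntegral_le_of_Icc {f : ℝ → ℝ} (hf : IntegrableOn f (Icc 0 1))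
    (hf0 : ∀ r ∈ Icc (0:ℝ) 1, 0 ≤ f r) {s t : ℝ} (hs : s ∈ Icc (0:ℝ) 1) (ht : t ∈ Icc (0:ℝ) 1)
    (hst : s ≤ t) : ∫ r in s..t, f r ≤ ∫ r in Icc (0:ℝ) 1, f r := by
  rw [intervalIntegral.integral_of_le hst]
  refine setIntegral_mono_set hf ?_ ?_
  · filter_upwards [ae_restrict_mem measurableSet_Icc] with r hr using hf0 r hr
  · exact (Ioc_subset_Icc_self.trans (Icc_subset_Icc hs.1 ht.2)).eventuallyLE

lemma IsSol.sub_eq (hD : DominatedCoeff b σ) {h : ℝ → EuclideanSpace ℝ (Fin d)}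
    (hh : Continuous h) {l : ℝ → EuclideanSpace ℝ (Fin m)} (hl : Adm l)
    (hsol : IsSol b σ x₀ l h) {s t : ℝ} (hs : s ∈ Icc (0:ℝ) 1) (ht : t ∈ Icc (0:ℝ) 1) :
    h t - h s = ∫ r in s..t, (b r (h r) + mVec (σ r (h r)) (l r)) := by
  have hI : IntegrableOn (fun r => b r (h r) + mVec (σ r (h r)) (l r)) (Icc 0 1) :=
    (hD.integrableOn_drift hh).add (hD.integrableOn_diffusion hh hl)
  have h0 : (0:ℝ) ∈ Icc (0:ℝ) 1 := ⟨le_rfl, zero_le_one⟩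
  rw [hsol.2 t ht, hsol.2 s hs, add_sub_add_left_eq_sub]
  exact intervalIntegral.integral_interval_sub_left (intervalIntegrable_of_Icc hI h0 ht)
    (intervalIntegrable_of_Icc hI h0 hs)

lemma IsSol.apply_zero {h : ℝ → EuclideanSpace ℝ (Fin d)} {l : ℝ → EuclideanSpace ℝ (Fin m)}
    (hsol : IsSol b σ x₀ l h) : h 0 = x₀ := by
  have := hsol.2 0 ⟨le_rfl, zero_le_one⟩
  simpa using this

/-- Solutions driven by controls of bounded energy are uniformly bounded. -/
lemma exists_norm_bound_of_growth (hD : DominatedCoeff b σ) (x₀ : EuclideanSpace ℝ (Fin d)) {K : ℝ}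
    (hK : 0 < K) {g γ : ℝ → ℝ} (hg_int : IntegrableOn (fun t => g t ^ 2) (Icc 0 1)) (hγ_cont : ContinuousOn γ (Ici 0))
    (hγ_nonneg : ∀ u ∈ Ici (0:ℝ), 0 ≤ γ u)
    (hγ_int : ∫⁻ s in Ioi K, ENNReal.ofReal (1 / (γ s + 1)) = ⊤)
    (hgrowth : ∀ t ∈ Icc (0:ℝ) 1, ∀ x : EuclideanSpace ℝ (Fin d), K ≤ ‖x‖ →
      max (frobSq (σ t x) + 2 * ⟪x, b t x⟫) ‖mVecT (σ t x) x‖ ≤ g t * (γ (‖x‖ ^ 2) + 1))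
    (β : ℝ) :
    ∃ R > 0, ∀ (h : ℝ → EuclideanSpace ℝ (Fin d)) (l : ℝ → EuclideanSpace ℝ (Fin m)),
      Continuous h → Adm l → IsSol b σ x₀ l h → ∫ t in Icc (0:ℝ) 1, ‖l t‖ ^ 2 ≤ β →
      ∀ t ∈ Icc (0:ℝ) 1, ‖h t‖ ≤ R := by
  set ψ : ℝ → ℝ := fun x => γ (max x 0) + 1 with hψ
  have hψc : Continuous ψ :=
    (hγ_cont.comp_continuous (continuous_id.max continuous_const) fun x => mem_Ici.2 (le_max_right _ _)).add
      continuous_const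
  have hψ1 : ∀ x, 1 ≤ ψ x := fun x => by
    have := hγ_nonneg (max x 0) (mem_Ici.2 (le_max_right _ _))
    simp only [hψ]
    linarith
  have hψeq : ∀ x, 0 ≤ x → ψ x = γ x + 1 := fun x hx => by simp only [hψ, max_eq_left hx]
  have hint : ∫⁻ s in Ioi K, ENNReal.ofReal (1 / ψ s) = ⊤ := by
    rw [← hγ_int]
    refine setLIntegral_congr_fun measurableSet_Ioi fun s hs => ?_
    simp only [hψeq s (hK.le.trans (le_of_lt hs))]
  obtain ⟨R, hR⟩ := exists_norm_sq_bound (E := EuclideanSpace ℝ (Fin d)) hψc hψ1 hint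
    (N := K ^ 2) (M := K ^ 2 + 1 + ‖x₀‖ ^ 2) (by nlinarith [sq_nonneg ‖x₀‖])
    ((∫ t in Icc (0:ℝ) 1, (1 + 2 * g t ^ 2)) + β)
  refine ⟨max R 1, by positivity, fun h l hh hl hsol hβ t ht => ?_⟩
  have hgi : IntegrableOn (fun t => 1 + 2 * g t ^ 2) (Icc 0 1) :=
    (integrable_const (1:ℝ)).add (hg_int.const_mul 2)
  have key : ‖h t‖ ^ 2 ≤ R := by
    refine hR h (fun r => b r (h r) + mVec (σ r (h r)) (l r))
      (fun r => (1 + 2 * g r ^ 2) + ‖l r‖ ^ 2) hh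
      ((hD.integrableOn_drift hh).add (hD.integrableOn_diffusion hh hl)) (hgi.add hl.2)
      (fun r => by positivity) ?_ (fun s hs t ht => hsol.sub_eq hD hh hl hs ht) ?_ ?_ t ht
    · rw [integral_add hgi hl.2]
      linarith
    · intro r hr hKr
      have hK' : K ≤ ‖h r‖ := by
        by_contra! hlt
        nlinarith [norm_nonneg (h r)]
      have h1 := hgrowth r hr (h r) hK'
      rw [← hψeq _ (sq_nonneg _)] at h1
      have h2 := (le_max_left _ _).trans h1
      have h3 := (le_max_right _ _).trans h1
      have h4 := frobSq_nonneg (σ r (h r))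
      rw [inner_add_right, inner_mVec]
      have h5 := real_inner_le_norm (mVecT (σ r (h r)) (h r)) (l r)
      have h6 := mul_le_mul_of_nonneg_right h3 (norm_nonneg (l r))
      have h7 := hψ1 (‖h r‖ ^ 2)
      have h8 : g r + 2 * (g r * ‖l r‖) ≤ 1 + 2 * g r ^ 2 + ‖l r‖ ^ 2 := by
        nlinarith [sq_nonneg (g r - ‖l r‖), sq_nonneg (g r - 1), sq_nonneg (g r)]
      have h9 := mul_le_mul_of_nonneg_right h8 (zero_le_one.trans h7)
      nlinarith
    · rw [hsol.apply_zero]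
      nlinarith
  refine abs_le_of_sq_le_sq' ?_ (by positivity) |>.2
  have : max R 1 ≤ max R 1 ^ 2 := by nlinarith [le_max_right R 1]
  exact key.trans ((le_max_left _ _).trans this)

/-- Bounded solutions driven by controls of bounded energy have a common modulus of continuity. -/
lemma exists_modulus_of_bound (hD : DominatedCoeff b σ) (x₀ : EuclideanSpace ℝ (Fin d))
    {R : ℝ} (hR : 0 < R) {β : ℝ} (hβ : 0 < β) {ε : ℝ} (hε : 0 < ε) :
    ∃ P : ℝ → ℝ, ContinuousOn P (Icc 0 1) ∧
      ∀ (h : ℝ → EuclideanSpace ℝ (Fin d)) (l : ℝ → EuclideanSpace ℝ (Fin m)),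
      Continuous h → Adm l → IsSol b σ x₀ l h → ∫ t in Icc (0:ℝ) 1, ‖l t‖ ^ 2 ≤ β →
      (∀ t ∈ Icc (0:ℝ) 1, ‖h t‖ ≤ R) →
      ∀ s ∈ Icc (0:ℝ) 1, ∀ t ∈ Icc (0:ℝ) 1, ‖h t - h s‖ ≤ |P t - P s| + ε := by
  obtain ⟨Θ, hΘ, hb⟩ := hD.exists_bound R hR
  set δ := ε / β with hδ
  have hδ0 : 0 < δ := by positivity
  have hΘ' : IntegrableOn (fun r => (1 + 1 / δ) * Θ r) (Icc 0 1) := hΘ.const_mul _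
  have h0 : (0:ℝ) ∈ Icc (0:ℝ) 1 := ⟨le_rfl, zero_le_one⟩
  refine ⟨fun t => ∫ r in (0:ℝ)..t, (1 + 1 / δ) * Θ r, ?_, fun h l hh hl hsol hlβ hhR => ?_⟩
  · have := intervalIntegral.continuousOn_primitive_interval (μ := volume) (a := 0) (b := 1)
      (f := fun r => (1 + 1 / δ) * Θ r) (by rwa [uIcc_of_le zero_le_one])
    rwa [uIcc_of_le zero_le_one] at this
  have main : ∀ s ∈ Icc (0:ℝ) 1, ∀ t ∈ Icc (0:ℝ) 1, s ≤ t → ‖h t - h s‖ ≤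
      |(∫ r in (0:ℝ)..t, (1 + 1 / δ) * Θ r) - ∫ r in (0:ℝ)..s, (1 + 1 / δ) * Θ r| + ε := by
    intro s hs t ht hst
    rw [intervalIntegral.integral_interval_sub_left (intervalIntegrable_of_Icc hΘ' h0 ht)
      (intervalIntegrable_of_Icc hΘ' h0 hs), hsol.sub_eq hD hh hl hs ht]
    have hlI : IntegrableOn (fun r => δ * ‖l r‖ ^ 2) (Icc 0 1) := hl.2.const_mul δ
    have h1 : ‖∫ r in s..t, (b r (h r) + mVec (σ r (h r)) (l r))‖
        ≤ ∫ r in s..t, ((1 + 1 / δ) * Θ r + δ * ‖l r‖ ^ 2) := by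
      refine intervalIntegral.norm_integral_le_of_norm_le hst
        (Filter.Eventually.of_forall fun r hr => ?_)
        ((intervalIntegrable_of_Icc hΘ' hs ht).add (intervalIntegrable_of_Icc hlI hs ht))
      have hr' : r ∈ Icc (0:ℝ) 1 := ⟨hs.1.trans hr.1.le, hr.2.trans ht.2⟩
      have h2 := hb r hr' (h r) (hhR r hr')
      have h3 := norm_mVec_le_young (σ r (h r)) (l r) hδ0
      have h4 := norm_add_le (b r (h r)) (mVec (σ r (h r)) (l r))
      have h5 : frobSq (σ r (h r)) / δ ≤ 1 / δ * Θ r := by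
        rw [one_div_mul_eq_div]
        gcongr
        linarith [norm_nonneg (b r (h r))]
      linarith [frobSq_nonneg (σ r (h r))]
    rw [intervalIntegral.integral_add (intervalIntegrable_of_Icc hΘ' hs ht)
      (intervalIntegrable_of_Icc hlI hs ht)] at h1
    have h6 := intervalIntegral_le_of_Icc hlI (fun r _ => by positivity) hs ht hst
    rw [integral_const_mul] at h6
    have h7 : δ * (∫ r in Icc (0:ℝ) 1, ‖l r‖ ^ 2) ≤ ε := by
      calc δ * (∫ r in Icc (0:ℝ) 1, ‖l r‖ ^ 2) ≤ δ * β := by gcongr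
        _ = ε := by rw [hδ]; field_simp
    linarith [le_abs_self (∫ r in s..t, (1 + 1 / δ) * Θ r)]
  intro s hs t ht
  rcases le_total s t with hst | hst
  · exact main s hs t ht hst
  · rw [norm_sub_rev, abs_sub_comm]
    exact main t ht s hs hst

lemma Adm.memLp {l : ℝ → EuclideanSpace ℝ (Fin m)} (hl : Adm l) :
    MemLp l 2 (volume.restrict (Icc 0 1)) :=
  (memLp_two_iff_integrable_sq_norm hl.1).2 hl.2

lemma MeasureTheory.MemLp.adm {l : ℝ → EuclideanSpace ℝ (Fin m)}
    (hl : MemLp l 2 (volume.restrict (Icc 0 1))) : Adm l :=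
  ⟨hl.1, (memLp_two_iff_integrable_sq_norm hl.1).1 hl⟩

lemma norm_toLp_sq {l : ℝ → EuclideanSpace ℝ (Fin m)}
    (hl : MemLp l 2 (volume.restrict (Icc 0 1))) :
    ‖hl.toLp l‖ ^ 2 = ∫ t in Icc (0:ℝ) 1, ‖l t‖ ^ 2 := by
  rw [← real_inner_self_eq_norm_sq, L2.inner_def]
  refine integral_congr_ae ?_
  filter_upwards [hl.coeFn_toLp] with t ht
  rw [ht, real_inner_self_eq_norm_sq]

/-- Along a fixed path, a coordinate of the control term is a continuous linear functional of the
control in `L²`. -/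
lemma DominatedCoeff.exists_inner_eq (hD : DominatedCoeff b σ)
    {h : ℝ → EuclideanSpace ℝ (Fin d)} (hh : Continuous h) (e : EuclideanSpace ℝ (Fin d))
    {t : ℝ} (ht : t ∈ Icc (0:ℝ) 1) :
    ∃ v : Lp (EuclideanSpace ℝ (Fin m)) 2 (volume.restrict (Icc (0:ℝ) 1)),
      ∀ (l : ℝ → EuclideanSpace ℝ (Fin m)) (hl : MemLp l 2 (volume.restrict (Icc 0 1))),
        ⟪e, ∫ s in (0:ℝ)..t, (b s (h s) + mVec (σ s (h s)) (l s))⟫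
          = ⟪e, ∫ s in (0:ℝ)..t, b s (h s)⟫ + ⟪hl.toLp l, v⟫ := by
  obtain ⟨Θ, hΘ, hb⟩ := hD.exists_bound_path hh
  have hsub : Ioc 0 t ⊆ Icc (0:ℝ) 1 := Ioc_subset_Icc_self.trans (Icc_subset_Icc le_rfl ht.2)
  have h0 : (0:ℝ) ∈ Icc (0:ℝ) 1 := ⟨le_rfl, zero_le_one⟩
  have hmeas : Measurable fun s => mVecT (σ s (h s)) e :=
    measurable_mVecT (hD.measurable_diffusion_comp hh) e
  have hw : MemLp (fun s => mVecT (σ s (h s)) e) 2 (volume.restrict (Icc (0:ℝ) 1)) := by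
    rw [memLp_two_iff_integrable_sq_norm hmeas.aestronglyMeasurable]
    refine Integrable.mono' (hΘ.mul_const (‖e‖ ^ 2))
      (hmeas.norm.pow_const 2).aestronglyMeasurable ?_
    filter_upwards [ae_restrict_mem measurableSet_Icc] with s hs
    rw [Real.norm_of_nonneg (by positivity)]
    refine (norm_mVecT_sq_le _ _).trans (mul_le_mul_of_nonneg_right ?_ (by positivity))
    linarith [hb s hs, norm_nonneg (b s (h s))]
  have hv : MemLp ((Ioc 0 t).indicator fun s => mVecT (σ s (h s)) e) 2
      (volume.restrict (Icc (0:ℝ) 1)) := hw.indicator measurableSet_Ioc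
  refine ⟨hv.toLp _, fun l hl => ?_⟩
  have hσI := intervalIntegrable_of_Icc (hD.integrableOn_diffusion hh hl.adm) h0 ht
  rw [intervalIntegral.integral_add (intervalIntegrable_of_Icc (hD.integrableOn_drift hh) h0 ht) hσI,
    inner_add_right]
  congr 1
  have h1 := (innerSL ℝ e).intervalIntegral_comp_comm hσI
  simp only [innerSL_apply_apply, inner_mVec] at h1
  rw [← h1, L2.inner_def, intervalIntegral.integral_of_le ht.1]
  have h2 : ∫ s in Icc (0:ℝ) 1, ⟪hl.toLp l s, hv.toLp _ s⟫
      = ∫ s in Icc (0:ℝ) 1, (Ioc 0 t).indicator (fun s => ⟪mVecT (σ s (h s)) e, l s⟫) s := by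
    refine integral_congr_ae ?_
    filter_upwards [hl.coeFn_toLp, hv.coeFn_toLp] with s h3 h4
    rw [h3, h4, real_inner_comm]
    by_cases hs : s ∈ Ioc 0 t
    · simp only [indicator_of_mem hs]
    · simp only [indicator_of_notMem hs, inner_zero_left]
  rw [h2, integral_indicator measurableSet_Ioc, Measure.restrict_restrict measurableSet_Ioc,
    inter_eq_left.2 hsub]

/-- Solutions with converging paths and controls whose energy bounds converge: the limit path is a
solution, with energy at most the limit of the bounds. -/
lemma exists_isSol_of_tendsto (hD : DominatedCoeff b σ) {H G : ℝ → ℝ}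
    (hH_cont : ContinuousOn H (Ici 0)) (hH_mono : MonotoneOn H (Ici 0)) (hH0 : H 0 = 0)
    (hG_nonneg : ∀ t, 0 ≤ G t) (hG_int : IntegrableOn (fun t => G t ^ 2) (Icc 0 1))
    (hmod : ∀ t ∈ Icc (0:ℝ) 1, ∀ x y,
      √(frobSq (σ t x - σ t y)) + ‖b t x - b t y‖ ≤ G t * H ‖x - y‖)
    {hn : ℕ → ℝ → EuclideanSpace ℝ (Fin d)} {h : ℝ → EuclideanSpace ℝ (Fin d)}
    (hhn : ∀ n, Continuous (hn n)) (hh : Continuous h) {δ : ℕ → ℝ}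
    (hδ : Filter.Tendsto δ Filter.atTop (nhds 0)) (hδ_nonneg : ∀ n, 0 ≤ δ n)
    (hdist : ∀ n, ∀ t ∈ Icc (0:ℝ) 1, ‖hn n t - h t‖ ≤ δ n)
    {l : ℕ → ℝ → EuclideanSpace ℝ (Fin m)} (hl : ∀ n, Adm (l n))
    (hsol : ∀ n, IsSol b σ x₀ (l n) (hn n)) {a : ℕ → ℝ} {a₀ : ℝ}
    (ha : Filter.Tendsto a Filter.atTop (nhds a₀))
    (hla : ∀ n, ∫ t in Icc (0:ℝ) 1, ‖l n t‖ ^ 2 ≤ a n) :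
    ∃ l' : ℝ → EuclideanSpace ℝ (Fin m), Adm l' ∧ IsSol b σ x₀ l' h ∧
      ∫ t in Icc (0:ℝ) 1, ‖l' t‖ ^ 2 ≤ a₀ := by
  have h0 : (0:ℝ) ∈ Icc (0:ℝ) 1 := ⟨le_rfl, zero_le_one⟩
  have ha0 : 0 ≤ a₀ := ge_of_tendsto' ha fun n =>
    (integral_nonneg fun t => by positivity).trans (hla n)
  obtain ⟨L, hL, hlim⟩ := exists_weak_limit_hyperfilter (fun n => (hl n).memLp.toLp (l n))
    (fun n => √(a n)) (√a₀) ((Real.continuous_sqrt.tendsto a₀).comp ha) fun n => by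
      refine Real.le_sqrt_of_sq_le ?_
      rw [norm_toLp_sq]
      exact hla n
  have hLm : MemLp L 2 (volume.restrict (Icc (0:ℝ) 1)) := Lp.memLp L
  refine ⟨L, hLm.adm, ⟨hh.continuousOn, fun t ht => ?_⟩, ?_⟩
  swap
  · rw [← norm_toLp_sq hLm, Lp.toLp_coeFn]
    calc ‖L‖ ^ 2 ≤ √a₀ ^ 2 := pow_le_pow_left₀ (norm_nonneg _) hL 2
      _ = a₀ := Real.sq_sqrt ha0
  obtain ⟨A, hA⟩ := ha.bddAbove_range
  set J : (ℝ → EuclideanSpace ℝ (Fin m)) → EuclideanSpace ℝ (Fin d) :=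
    fun l => ∫ s in (0:ℝ)..t, (b s (h s) + mVec (σ s (h s)) (l s)) with hJ
  have hGG : IntegrableOn (fun s => 1 + 2 * G s ^ 2) (Icc 0 1) :=
    (integrable_const (1:ℝ)).add (hG_int.const_mul 2)
  set D : ℝ := (∫ s in Icc (0:ℝ) 1, (1 + 2 * G s ^ 2)) + A with hDdef
  have hHn : ∀ n, 0 ≤ H (δ n) := fun n =>
    hH0 ▸ hH_mono (mem_Ici.2 le_rfl) (mem_Ici.2 (hδ_nonneg n)) (hδ_nonneg n)
  have hdiff : ∀ n, ‖hn n t - x₀ - J (l n)‖ ≤ H (δ n) * D := by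
    intro n
    have hB : IntegrableOn (fun s => H (δ n) * ((1 + 2 * G s ^ 2) + ‖l n s‖ ^ 2)) (Icc 0 1) :=
      (hGG.add (hl n).2).const_mul _
    have hI1 : IntegrableOn (fun s => b s (hn n s) + mVec (σ s (hn n s)) (l n s)) (Icc 0 1) :=
      (hD.integrableOn_drift (hhn n)).add (hD.integrableOn_diffusion (hhn n) (hl n))
    have hI2 : IntegrableOn (fun s => b s (h s) + mVec (σ s (h s)) (l n s)) (Icc 0 1) :=
      (hD.integrableOn_drift hh).add (hD.integrableOn_diffusion hh (hl n))
    rw [(hsol n).2 t ht, add_sub_cancel_left, hJ]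
    simp only
    rw [← intervalIntegral.integral_sub (intervalIntegrable_of_Icc hI1 h0 ht)
      (intervalIntegrable_of_Icc hI2 h0 ht)]
    refine (intervalIntegral.norm_integral_le_of_norm_le ht.1
      (Filter.Eventually.of_forall fun s hs => ?_)
      (intervalIntegrable_of_Icc hB h0 ht)).trans
      ((intervalIntegral_le_of_Icc hB (fun s _ => mul_nonneg (hHn n) (by positivity)) h0 ht
        ht.1).trans ?_)
    · have hs' : s ∈ Icc (0:ℝ) 1 := ⟨hs.1.le, hs.2.trans ht.2⟩
      have h1 := hmod s hs' (hn n s) (h s)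
      have h2 : H ‖hn n s - h s‖ ≤ H (δ n) :=
        hH_mono (mem_Ici.2 (norm_nonneg _)) (mem_Ici.2 (hδ_nonneg n)) (hdist n s hs')
      have h3 := h1.trans (mul_le_mul_of_nonneg_left h2 (hG_nonneg s))
      have h4 : b s (hn n s) + mVec (σ s (hn n s)) (l n s)
          - (b s (h s) + mVec (σ s (h s)) (l n s))
          = (b s (hn n s) - b s (h s)) + mVec (σ s (hn n s) - σ s (h s)) (l n s) := by
        rw [mVec_sub]
        abel
      rw [h4]
      have h5 := norm_mVec_le (σ s (hn n s) - σ s (h s)) (l n s)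
      have h6 : √(frobSq (σ s (hn n s) - σ s (h s))) ≤ G s * H (δ n) := by
        linarith [norm_nonneg (b s (hn n s) - b s (h s))]
      have h7 := mul_le_mul_of_nonneg_right h6 (norm_nonneg (l n s))
      have h8 : G s + G s * ‖l n s‖ ≤ (1 + 2 * G s ^ 2) + ‖l n s‖ ^ 2 := by
        nlinarith [sq_nonneg (G s - ‖l n s‖), sq_nonneg (G s - 1)]
      have h9 := mul_le_mul_of_nonneg_left h8 (hHn n)
      have h10 := norm_add_le (b s (hn n s) - b s (h s))
        (mVec (σ s (hn n s) - σ s (h s)) (l n s))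
      linarith [Real.sqrt_nonneg (frobSq (σ s (hn n s) - σ s (h s)))]
    · rw [integral_const_mul, integral_add hGG (hl n).2]
      exact mul_le_mul_of_nonneg_left (add_le_add_right ((hla n).trans (hA ⟨n, rfl⟩)) _) (hHn n)
  have hHδ : Filter.Tendsto (fun n => H (δ n) * D) Filter.atTop (nhds 0) := by
    have h1 : Filter.Tendsto δ Filter.atTop (nhdsWithin 0 (Ici 0)) :=
      tendsto_nhdsWithin_iff.2 ⟨hδ, Filter.Eventually.of_forall hδ_nonneg⟩
    have h2 := ((hH_cont 0 (mem_Ici.2 le_rfl)).tendsto.comp h1).mul_const D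
    rwa [hH0, zero_mul] at h2
  have hdiff0 := squeeze_zero_norm hdiff hHδ
  have hht : Filter.Tendsto (fun n => hn n t) Filter.atTop (nhds (h t)) := by
    rw [tendsto_iff_norm_sub_tendsto_zero]
    exact squeeze_zero (fun n => norm_nonneg _) (fun n => hdist n t ht) hδ
  refine eq_of_sub_eq_zero ?_
  refine ext_inner_left ℝ fun e => ?_
  obtain ⟨v, hv⟩ := hD.exists_inner_eq hh e ht
  have hJlim : Filter.Tendsto (fun n => ⟪e, J (l n)⟫) (Filter.hyperfilter ℕ : Filter ℕ)
      (nhds ⟪e, J L⟫) := by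
    have h1 := (hlim v).const_add ⟪e, ∫ s in (0:ℝ)..t, b s (h s)⟫
    have h2 := hv L hLm
    rw [Lp.toLp_coeFn] at h2
    rw [← h2] at h1
    exact h1.congr fun n => (hv (l n) (hl n).memLp).symm
  have h3 : Filter.Tendsto (fun n => ⟪e, hn n t - x₀ - (hn n t - x₀ - J (l n))⟫) Filter.atTop
      (nhds ⟪e, h t - x₀ - 0⟫) :=
    ((continuous_const.inner continuous_id).tendsto _).comp ((hht.sub_const x₀).sub hdiff0)
  have h4 := tendsto_nhds_unique
    (hJlim.congr fun n => by rw [sub_sub_cancel]) (h3.mono_left Nat.hyperfilter_le_atTop)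
  rw [sub_zero] at h4
  rw [← sub_sub, inner_sub_right, ← h4, inner_zero_right]
  exact sub_self _

end Paths

/-- **Arzelà–Ascoli** for spaces of continuous maps on a compact space. -/
lemma isCompact_of_isClosed_of_equicontinuous {X E : Type*} [TopologicalSpace X] [CompactSpace X]
    [PseudoMetricSpace E] {s : Set E} (hs : IsCompact s) {A : Set C(X, E)} (hA : IsClosed A)
    (hAs : ∀ f ∈ A, ∀ x, f x ∈ s) (hequi : Equicontinuous fun (f : A) (x : X) => (f : C(X, E)) x) :
    IsCompact A := by
  let Φ := (ContinuousMap.isometryEquivBoundedOfCompact X E).toHomeomorph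
  rw [← Φ.symm.isCompact_preimage]
  refine BoundedContinuousFunction.arzela_ascoli₂ s hs _ (hA.preimage Φ.symm.continuous)
    (fun f x hf => hAs _ hf x) fun x U hU => ?_
  filter_upwards [hequi x U hU] with y hy f
  exact hy ⟨Φ.symm f, f.2⟩

/-- the rate function is good: every sublevel set
`{h : I(h) ≤ α}` is compact in `C([0,1], ℝ^d)` with the uniform metric. -/
theorem rate_function_is_good {d m : ℕ} (hd : 1 ≤ d) (hm : 1 ≤ m)
    (x₀ : EuclideanSpace ℝ (Fin d))
    (b : ℝ → EuclideanSpace ℝ (Fin d) → EuclideanSpace ℝ (Fin d))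
    (σ : ℝ → EuclideanSpace ℝ (Fin d) → Matrix (Fin d) (Fin m) ℝ)
    (hbmeas : Measurable (Function.uncurry b))
    (hσmeas : ∀ i j, Measurable fun p : ℝ × EuclideanSpace ℝ (Fin d) => σ p.1 p.2 i j)
    -- modulus-of-continuity condition
    (H G : ℝ → ℝ)
    (hH_cont : ContinuousOn H (Ici 0)) (hH_mono : MonotoneOn H (Ici 0))
    (hH0 : H 0 = 0) (hH_nonneg : ∀ u ∈ Ici (0:ℝ), 0 ≤ H u)
    (hG_nonneg : ∀ t, 0 ≤ G t)
    (hG_int : IntegrableOn (fun t => G t ^ 2) (Icc 0 1))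
    (hmod : ∀ t ∈ Icc (0:ℝ) 1, ∀ x y,
      Real.sqrt (frobSq (σ t x - σ t y)) + ‖b t x - b t y‖ ≤ G t * H ‖x - y‖)
    -- local integrability: ∫₀¹ sup_{|x| ≤ R} (|b(s,x)| + ‖σ(s,x)‖²) ds < ∞ for all R > 0
    (hloc : ∀ R > (0:ℝ), ∫⁻ s in Icc (0:ℝ) 1,
      ⨆ x ∈ Metric.closedBall (0 : EuclideanSpace ℝ (Fin d)) R,
        ENNReal.ofReal (‖b s x‖ + frobSq (σ s x)) < ⊤)
    -- local Osgood-type condition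
    (c₀ : ℝ) (hc₀ : c₀ ∈ Ioo (0:ℝ) 1)
    (hOsg : ∀ R > (0:ℝ), ∃ f η : ℝ → ℝ,
      (∀ t, 0 ≤ f t) ∧ IntegrableOn (fun t => f t ^ 2) (Icc 0 1) ∧
      DifferentiableOn ℝ η (Ico 0 1) ∧ η 0 = 0 ∧
      (∀ u ∈ Ico (0:ℝ) 1, 0 ≤ η u) ∧
      (∀ u ∈ Ico (0:ℝ) 1, 0 ≤ derivWithin η (Ico 0 1) u) ∧
      (∀ ε ∈ Ioo (0:ℝ) 1, ∫⁻ u in Ioc (0:ℝ) ε, ENNReal.ofReal (1 / η u) = ⊤) ∧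
      (∀ t ∈ Icc (0:ℝ) 1, ∀ x y : EuclideanSpace ℝ (Fin d),
        max ‖x‖ ‖y‖ ≤ R → ‖x - y‖ < c₀ →
        max (frobSq (σ t x - σ t y) + 2 * ⟪x - y, b t x - b t y⟫)
            ‖mVecT (σ t x - σ t y) (x - y)‖
          ≤ f t * η (‖x - y‖ ^ 2)))
    -- growth condition for |x| ≥ K
    (K : ℝ) (hK : 0 < K) (g γ : ℝ → ℝ)
    (hg_nonneg : ∀ t, 0 ≤ g t)
    (hg_int : IntegrableOn (fun t => g t ^ 2) (Icc 0 1))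
    (hγ_diff : DifferentiableOn ℝ γ (Ici 0))
    (hγ_nonneg : ∀ u ∈ Ici (0:ℝ), 0 ≤ γ u)
    (hγ_deriv : ∀ u ∈ Ici (0:ℝ), 0 ≤ derivWithin γ (Ici 0) u)
    (hγ_top : Filter.Tendsto γ Filter.atTop Filter.atTop)
    (hγ_int : ∫⁻ s in Ioi K, ENNReal.ofReal (1 / (γ s + 1)) = ⊤)
    (hgrowth : ∀ t ∈ Icc (0:ℝ) 1, ∀ x : EuclideanSpace ℝ (Fin d), K ≤ ‖x‖ →
      max (frobSq (σ t x) + 2 * ⟪x, b t x⟫) ‖mVecT (σ t x) x‖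
        ≤ g t * (γ (‖x‖ ^ 2) + 1))
    :
    ∀ α > (0:ℝ),
      IsCompact {h : C(Icc (0:ℝ) 1, EuclideanSpace ℝ (Fin d)) |
        rateI b σ x₀ h ≤ ENNReal.ofReal α} := by
  intro α hα
  have hzero : ∫⁻ s in Icc (0:ℝ) 1, ENNReal.ofReal (‖b s 0‖ + frobSq (σ s 0)) < ⊤ :=
    (lintegral_mono fun s =>
      le_iSup₂_of_le (f := fun x (_ : x ∈ closedBall (0 : EuclideanSpace ℝ (Fin d)) 1) =>
        ENNReal.ofReal (‖b s x‖ + frobSq (σ s x))) 0 (mem_closedBall_self zero_le_one)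
        le_rfl).trans_lt (hloc 1 one_pos)
  have hD : DominatedCoeff b σ :=
    dominatedCoeff_of_modulus hbmeas hσmeas hH_mono hG_nonneg hG_int hmod hzero
  have hext : ∀ h : C(Icc (0:ℝ) 1, EuclideanSpace ℝ (Fin d)),
      Continuous fun t => h (projIcc (0:ℝ) 1 zero_le_one t) := fun h =>
    h.continuous.comp continuous_projIcc
  have hctrl : ∀ h : C(Icc (0:ℝ) 1, EuclideanSpace ℝ (Fin d)),
      rateI b σ x₀ h ≤ ENNReal.ofReal α → ∀ β > α, ∃ l : ℝ → EuclideanSpace ℝ (Fin m), Adm l ∧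
        IsSol b σ x₀ l (fun t => h (projIcc (0:ℝ) 1 zero_le_one t)) ∧
        ∫ t in Icc (0:ℝ) 1, ‖l t‖ ^ 2 ≤ 2 * β := by
    intro h hI β hβ
    have hlt : rateI b σ x₀ h < ENNReal.ofReal β :=
      hI.trans_lt ((ENNReal.ofReal_lt_ofReal_iff (hα.trans hβ)).2 hβ)
    simp only [rateI, iInf_lt_iff] at hlt
    obtain ⟨l, ⟨hl, hsol⟩, hlβ⟩ := hlt
    rw [ENNReal.ofReal_lt_ofReal_iff (hα.trans hβ)] at hlβ
    exact ⟨l, hl, hsol, by linarith⟩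
  obtain ⟨R, hR, hbound⟩ := exists_norm_bound_of_growth hD x₀ hK hg_int
    hγ_diff.continuousOn hγ_nonneg hγ_int hgrowth (2 * (α + 1))
  have hbound' : ∀ h : C(Icc (0:ℝ) 1, EuclideanSpace ℝ (Fin d)),
      rateI b σ x₀ h ≤ ENNReal.ofReal α → ∀ t, ‖h t‖ ≤ R := by
    intro h hI t
    obtain ⟨l, hl, hsol, hlβ⟩ := hctrl h hI (α + 1) (lt_add_one α)
    simpa using hbound _ l (hext h) hl hsol hlβ t t.2
  refine isCompact_of_isClosed_of_equicontinuous (isCompact_closedBall 0 R) ?_ ?_ ?_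
  · rw [← isSeqClosed_iff_isClosed]
    intro hn h hmem hlim
    have hpos : ∀ n : ℕ, (0:ℝ) < 1 / ((n:ℝ) + 1) := fun n => Nat.one_div_pos_of_nat
    choose l hl hsol hlβ using fun n : ℕ =>
      hctrl (hn n) (hmem n) (α + 1 / ((n:ℝ) + 1)) (lt_add_of_pos_right α (hpos n))
    have ha : Filter.Tendsto (fun n : ℕ => 2 * (α + 1 / ((n:ℝ) + 1))) Filter.atTop
        (nhds (2 * α)) := by
      simpa using (tendsto_one_div_add_atTop_nhds_zero_nat.const_add α).const_mul (2:ℝ)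
    obtain ⟨l', hl', hsol', hle⟩ := exists_isSol_of_tendsto hD hH_cont hH_mono hH0 hG_nonneg hG_int
      hmod (fun n => hext (hn n)) (hext h) (tendsto_iff_dist_tendsto_zero.1 hlim)
      (fun n => dist_nonneg)
      (fun n t _ => by
        rw [← dist_eq_norm]
        exact ContinuousMap.dist_apply_le_dist _) hl hsol ha hlβ
    change rateI b σ x₀ h ≤ ENNReal.ofReal α
    rw [rateI]
    exact iInf₂_le_of_le l' ⟨hl', hsol'⟩ (ENNReal.ofReal_le_ofReal (by linarith))
  · intro h hI t
    simpa using hbound' h hI t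
  · intro (t : Icc (0:ℝ) 1)
    rw [Metric.equicontinuousAt_iff_right]
    intro ε hε
    obtain ⟨P, hP, hmodulus⟩ := exists_modulus_of_bound hD x₀ hR
      (β := 2 * (α + 1)) (by positivity) (half_pos hε)
    have hPt : Filter.Tendsto (fun s : Icc (0:ℝ) 1 => P s) (nhds t) (nhds (P t)) :=
      (continuousOn_iff_continuous_domRestrict.1 hP).tendsto t
    filter_upwards [Metric.tendsto_nhds.1 hPt (ε / 2) (half_pos hε)] with s hs
    rintro ⟨h, hI⟩
    obtain ⟨l, hl, hsol, hlβ⟩ := hctrl h hI (α + 1) (lt_add_one α)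
    have h1 := hmodulus _ l (hext h) hl hsol hlβ
      (fun r _ => hbound' h hI _) s s.2 t t.2
    rw [Real.dist_eq, abs_sub_comm] at hs
    simp only [projIcc_val] at h1
    rw [dist_eq_norm]
    linarith
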